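/- Let $G$ be a subgroup of the symmetric group on a finite set $\Omega$ of size $n$, and suppose the action of $G$ on $\Omega$ has exactly $s$ orbits. Then every composition series of $G$ has length at most $4(n-s)/3$. -/

import Mathlib

universe u v

/-- `HasSubnormalSeries n G` says that `G` has a strictly increasing subnormal series of length `n`
ending at `G`. -/
def HasSubnormalSeries : ℕ → ∀ (G : Type u) [Group G], Prop
  | 0, _, _ => True
  | n + 1, G, _ => ∃ N : Subgroup G, N.Normal ∧ N ≠ ⊤ ∧ HasSubnormalSeries n N

namespace HasSubnormalSeries

theorem congr {n : ℕ} : ∀ {G H : Type u} [Group G] [Group H], G ≃* H →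
    HasSubnormalSeries n G → HasSubnormalSeries n H := by
  induction n with
  | zero => intros; trivial
  | succ n ih =>
    rintro G H _ _ e ⟨N, hN, hne, h⟩
    refine ⟨N.map e.toMonoidHom, hN.map _ e.surjective, ?_, ih (e.subgroupMap N) h⟩
    intro htop
    apply hne
    rw [eq_top_iff]
    intro x _
    have : e x ∈ N.map e.toMonoidHom := htop ▸ Subgroup.mem_top _
    obtain ⟨y, hy, hyx⟩ := this
    exact e.injective hyx ▸ hy

theorem of_succ {n : ℕ} : ∀ {G : Type u} [Group G],
    HasSubnormalSeries (n + 1) G → HasSubnormalSeries n G := by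
  induction n with
  | zero => intros; trivial
  | succ n ih =>
    rintro G _ ⟨N, hN, hne, h⟩
    exact ⟨N, hN, hne, ih h⟩

theorem of_normal {n : ℕ} {G : Type u} [Group G] {N : Subgroup G} (hN : N.Normal)
    (h : HasSubnormalSeries n N) : HasSubnormalSeries n G := by
  by_cases hne : N = ⊤
  · subst hne
    exact h.congr Subgroup.topEquiv
  · exact of_succ ⟨N, hN, hne, h⟩

theorem exact_add {a b : ℕ} : ∀ {K G H : Type u} [Group K] [Group G] [Group H]
    (i : K →* G) (f : G →* H), Function.Injective i → Function.Surjective f →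
    i.range = f.ker → HasSubnormalSeries a K → HasSubnormalSeries b H →
    HasSubnormalSeries (a + b) G := by
  induction b with
  | zero =>
    intro K G H _ _ _ i f hi _ hex ha _
    refine of_normal (N := i.range) (hex ▸ inferInstance) (ha.congr (i.ofInjective hi))
  | succ b ih =>
    rintro K G H _ _ _ i f hi hf hex ha ⟨M, hM, hne, hb⟩
    refine ⟨M.comap f, hM.comap f, fun h => hne ?_, ?_⟩
    · rw [← Subgroup.map_comap_eq_self_of_surjective hf M, h, Subgroup.map_top_of_surjective f hf]
    have hik (k : K) : f (i k) = 1 := by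
      have : i k ∈ f.ker := hex ▸ ⟨k, rfl⟩
      exact this
    refine ih (i.codRestrict (M.comap f) fun k => ?_) (f.subgroupComap M) ?_ ?_ ?_ ha hb
    · rw [Subgroup.mem_comap, hik]
      exact one_mem _
    · intro x y hxy
      exact hi (congrArg Subtype.val hxy)
    · rintro ⟨y, hy⟩
      obtain ⟨x, rfl⟩ := hf y
      exact ⟨⟨x, hy⟩, rfl⟩
    · ext ⟨x, hx⟩
      have : x ∈ i.range ↔ x ∈ f.ker := by rw [hex]
      simp only [MonoidHom.mem_range, MonoidHom.mem_ker, Subtype.ext_iff] at this ⊢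
      exact this

theorem exact_split {n : ℕ} : ∀ {K G H : Type u} [Group K] [Group G] [Group H]
    (i : K →* G) (f : G →* H), Function.Injective i → Function.Surjective f →
    i.range = f.ker → HasSubnormalSeries n G →
    ∃ a b, n ≤ a + b ∧ HasSubnormalSeries a K ∧ HasSubnormalSeries b H := by
  induction n with
  | zero => intros; exact ⟨0, 0, le_rfl, trivial, trivial⟩
  | succ n ih =>
    rintro K G H _ _ _ i f hi hf hex ⟨M, hM, hne, hn⟩
    have hik (k : K) : f (i k) = 1 := by
      have : i k ∈ f.ker := hex ▸ ⟨k, rfl⟩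
      exact this
    obtain ⟨a, b, hab, ha, hb⟩ := ih (i.subgroupComap M) (f.subgroupMap M)
      (fun x y hxy => Subtype.ext (hi (congrArg Subtype.val hxy)))
      (f.subgroupMap_surjective M) (by
        ext ⟨x, hx⟩
        have : x ∈ i.range ↔ x ∈ f.ker := by rw [hex]
        simp only [MonoidHom.mem_range, MonoidHom.mem_ker, Subtype.ext_iff] at this ⊢
        refine Iff.trans ⟨?_, ?_⟩ this
        · rintro ⟨y, hy⟩
          exact ⟨y, hy⟩
        · rintro ⟨y, rfl⟩
          exact ⟨⟨y, hx⟩, rfl⟩) hn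
    have hK : (M.comap i).Normal := hM.comap i
    have hH : (M.map f).Normal := hM.map f hf
    by_cases h1 : M.comap i = ⊤
    · refine ⟨a, b + 1, by omega, ha.of_normal hK, M.map f, hH, fun h2 => hne ?_, hb⟩
      rw [eq_top_iff]
      intro x _
      have : f x ∈ M.map f := h2 ▸ Subgroup.mem_top _
      obtain ⟨y, hy, hyx⟩ := this
      have hker : y⁻¹ * x ∈ i.range := by
        rw [hex, MonoidHom.mem_ker, map_mul, map_inv, hyx, inv_mul_cancel]
      obtain ⟨k, hk⟩ := hker
      have hkM : k ∈ M.comap i := h1 ▸ Subgroup.mem_top _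
      rw [Subgroup.mem_comap, hk] at hkM
      simpa using mul_mem hy hkM
    · exact ⟨a + 1, b, by omega, ⟨_, hK, h1, ha⟩, hb.of_normal hH⟩

theorem le_cardFactors {n : ℕ} : ∀ {G : Type u} [Group G] [Finite G],
    HasSubnormalSeries n G → n ≤ ArithmeticFunction.cardFactors (Nat.card G) := by
  induction n with
  | zero => intros; exact Nat.zero_le _
  | succ n ih =>
    rintro G _ _ ⟨N, _, hne, h⟩
    rw [← N.card_mul_index, ArithmeticFunction.cardFactors_mul Nat.card_pos.ne'
      N.index_ne_zero_of_finite]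
    have h1 := ih h
    have h2 : 0 < ArithmeticFunction.cardFactors N.index :=
      ArithmeticFunction.cardFactors_pos_iff_one_lt.2 (N.one_lt_index_of_ne_top hne)
    omega

end HasSubnormalSeries

/-- The maximal length of a strictly increasing subnormal series of `G`; for finite groups this is
the composition length. -/
noncomputable def subnormalLength (G : Type u) [Group G] : ℕ :=
  sSup {n | HasSubnormalSeries n G}

section subnormalLength

variable {K G H : Type u} [Group K] [Group G] [Group H]

theorem bddAbove_hasSubnormalSeries [Finite G] : BddAbove {n | HasSubnormalSeries n G} :=
  ⟨_, fun _ h => HasSubnormalSeries.le_cardFactors h⟩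

theorem HasSubnormalSeries.le_subnormalLength [Finite G] {n : ℕ} (h : HasSubnormalSeries n G) :
    n ≤ subnormalLength G :=
  le_csSup bddAbove_hasSubnormalSeries h

theorem hasSubnormalSeries_subnormalLength [Finite G] :
    HasSubnormalSeries (subnormalLength G) G :=
  Nat.sSup_mem (s := {n | HasSubnormalSeries n G}) ⟨0, trivial⟩ bddAbove_hasSubnormalSeries

theorem subnormalLength_le_cardFactors [Finite G] :
    subnormalLength G ≤ ArithmeticFunction.cardFactors (Nat.card G) :=
  hasSubnormalSeries_subnormalLength.le_cardFactors

theorem subnormalLength_congr (e : G ≃* H) : subnormalLength G = subnormalLength H := by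
  unfold subnormalLength
  congr 1
  ext n
  exact ⟨fun h => h.congr e, fun h => h.congr e.symm⟩

theorem subnormalLength_eq_of_exact [Finite G] (i : K →* G) (f : G →* H)
    (hi : Function.Injective i) (hf : Function.Surjective f) (hex : i.range = f.ker) :
    subnormalLength G = subnormalLength K + subnormalLength H := by
  have : Finite K := Finite.of_injective i hi
  have : Finite H := Finite.of_surjective f hf
  apply le_antisymm
  · obtain ⟨a, b, hab, ha, hb⟩ :=
      (hasSubnormalSeries_subnormalLength (G := G)).exact_split i f hi hf hex
    exact hab.trans (Nat.add_le_add ha.le_subnormalLength hb.le_subnormalLength)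
  · exact (HasSubnormalSeries.exact_add i f hi hf hex hasSubnormalSeries_subnormalLength
      hasSubnormalSeries_subnormalLength).le_subnormalLength

theorem subnormalLength_eq_ker_add_range [Finite G] {H : Type v} [Group H] (f : G →* H) :
    subnormalLength G = subnormalLength f.ker + subnormalLength (G ⧸ f.ker) :=
  subnormalLength_eq_of_exact f.ker.subtype (QuotientGroup.mk' f.ker) Subtype.val_injective
    (QuotientGroup.mk'_surjective _) (by simp)

theorem subnormalLength_pos [Finite G] [Nontrivial G] : 0 < subnormalLength G :=
  HasSubnormalSeries.le_subnormalLength (n := 1) ⟨⊥, inferInstance, bot_ne_top, trivial⟩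

theorem subnormalLength_eq_zero [Subsingleton G] : subnormalLength G = 0 := by
  have := subnormalLength_le_cardFactors (G := G)
  simpa using this

theorem subnormalLength_le_one [Finite G] [IsSimpleGroup G] : subnormalLength G ≤ 1 := by
  by_contra! h
  obtain ⟨n, hn⟩ := Nat.exists_eq_add_of_lt h
  obtain ⟨N, hN, hne, hs⟩ : HasSubnormalSeries (1 + n + 1) G :=
    hn ▸ hasSubnormalSeries_subnormalLength
  obtain rfl := hN.eq_bot_or_eq_top.resolve_right hne
  have := hs.le_subnormalLength
  rw [subnormalLength_eq_zero] at this
  omega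

end subnormalLength

section DirectProduct

variable {G H K : Type u} [Group G] [Group H] [Group K]

theorem subnormalLength_prod [Finite G] [Finite H] :
    subnormalLength (G × H) = subnormalLength G + subnormalLength H :=
  subnormalLength_eq_of_exact (MonoidHom.inl G H) (MonoidHom.snd G H)
    (fun _ _ h => congrArg Prod.fst h) Prod.snd_surjective (by
      ext ⟨x, y⟩
      simp [MonoidHom.mem_range, Subgroup.mem_prod, eq_comm])

/-- Every subgroup of `G` has order at most `q` to the power of its composition length. -/
def SubgroupsBounded (q : ℕ) (G : Type u) [Group G] : Prop :=
  ∀ A : Subgroup G, Nat.card A ≤ q ^ subnormalLength A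

theorem SubgroupsBounded.of_injective {q : ℕ} (h : SubgroupsBounded q G) (f : H →* G)
    (hf : Function.Injective f) : SubgroupsBounded q H := by
  intro A
  have e : A ≃* A.map f := A.equivMapOfInjective f hf
  rw [Nat.card_congr e.toEquiv, subnormalLength_congr e]
  exact h _

theorem card_le_pow_subnormalLength [Finite G] {q : ℕ} (h : Nat.card G ≤ q) :
    Nat.card G ≤ q ^ subnormalLength G := by
  rcases subsingleton_or_nontrivial G with hG | hG
  · have hq : 1 ≤ q := Nat.card_pos.trans_le h
    rw [Nat.card_of_subsingleton (1 : G)]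
    exact Nat.one_le_pow _ _ hq
  · exact h.trans (Nat.le_self_pow subnormalLength_pos.ne' q)

theorem SubgroupsBounded.prod [Finite G] [Finite H] {q : ℕ} (h : SubgroupsBounded q G)
    (hH : Nat.card H ≤ q) : SubgroupsBounded q (G × H) := by
  intro A
  let f : A →* H := (MonoidHom.snd G H).comp A.subtype
  let g : f.ker →* G := (MonoidHom.fst G H).comp (A.subtype.comp f.ker.subtype)
  have hg : Function.Injective g := by
    rintro ⟨⟨⟨a, b⟩, h1⟩, h2⟩ ⟨⟨⟨c, d⟩, h3⟩, h4⟩ h5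
    have h2' : b = 1 := h2
    have h4' : d = 1 := h4
    have h5' : a = c := h5
    subst h2' h4' h5'
    rfl
  have h1 : Nat.card f.ker ≤ q ^ subnormalLength f.ker := by
    have := h.of_injective g hg ⊤
    rwa [Nat.card_congr Subgroup.topEquiv.toEquiv, subnormalLength_congr Subgroup.topEquiv] at this
  have h2 : Nat.card f.range ≤ q ^ subnormalLength f.range :=
    card_le_pow_subnormalLength ((Subgroup.card_le_card_group f.range).trans hH)
  have e := QuotientGroup.quotientKerEquivRange f
  rw [← Nat.card_congr e.toEquiv, ← subnormalLength_congr e] at h2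
  rw [subnormalLength_eq_ker_add_range f, pow_add, f.ker.card_eq_card_quotient_mul_card_subgroup,
    mul_comm]
  exact Nat.mul_le_mul h1 h2

theorem exists_prod_mulEquiv_sup {M U : Subgroup G} (hc : ∀ m ∈ M, ∀ u ∈ U, Commute m u)
    (hd : Disjoint M U) : Nonempty (M × U ≃* (M ⊔ U : Subgroup G)) := by
  have hc' : ∀ (m : M) (u : U), Commute (M.subtype m) (U.subtype u) :=
    fun m u => hc m m.2 u u.2
  let f := MonoidHom.noncommCoprod M.subtype U.subtype hc'
  have hf : Function.Injective f := by
    rw [MonoidHom.noncommCoprod_injective]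
    exact ⟨Subtype.val_injective, Subtype.val_injective, by simpa using hd⟩
  have hr : f.range = M ⊔ U := by
    rw [MonoidHom.noncommCoprod_range]
    simp
  exact ⟨(f.ofInjective hf).trans (MulEquiv.subgroupCongr hr)⟩

theorem commute_of_mem_finset_sup {S : Finset (Subgroup G)} {U : Subgroup G}
    (h : ∀ V ∈ S, ∀ v ∈ V, ∀ u ∈ U, Commute v u) :
    ∀ m ∈ S.sup id, ∀ u ∈ U, Commute m u := by
  have : S.sup id ≤ Subgroup.centralizer (U : Set G) := by
    refine Finset.sup_le fun V hV v hv => ?_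
    rw [Subgroup.mem_centralizer_iff]
    exact fun u hu => (h V hV v hv u hu).symm.eq
  intro m hm u hu
  exact (Subgroup.mem_centralizer_iff.1 (this hm) u hu).symm

/-- The subgroup generated by pairwise commuting simple subgroups with trivial centre, all of the
same order, behaves like their direct product. -/
theorem card_and_subnormalLength_finset_sup [Finite G] {q : ℕ} (S : Finset (Subgroup G))
    (hq : ∀ U ∈ S, Nat.card U = q) (hs : ∀ U ∈ S, IsSimpleGroup U)
    (hz : ∀ U ∈ S, ∀ x ∈ U, (∀ u ∈ U, Commute x u) → x = 1)
    (hc : ∀ U ∈ S, ∀ V ∈ S, U ≠ V → ∀ u ∈ U, ∀ v ∈ V, Commute u v) :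
    Nat.card (S.sup id : Subgroup G) = q ^ S.card ∧
      subnormalLength (S.sup id : Subgroup G) = S.card ∧
      SubgroupsBounded q (S.sup id : Subgroup G) := by
  classical
  induction S using Finset.induction_on with
  | empty =>
    refine ⟨by simp, ?_, fun A => ?_⟩
    · rw [Finset.sup_empty, Finset.card_empty]
      exact subnormalLength_eq_zero
    · have hb : Subsingleton ((∅ : Finset (Subgroup G)).sup id : Subgroup G) := by
        rw [Finset.sup_empty]
        infer_instance
      have : Subsingleton A := inferInstance
      rw [subnormalLength_eq_zero]
      simp
  | insert U S hU ih =>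
    obtain ⟨h1, h2, h3⟩ := ih (fun V hV => hq V (Finset.mem_insert_of_mem hV))
      (fun V hV => hs V (Finset.mem_insert_of_mem hV))
      (fun V hV => hz V (Finset.mem_insert_of_mem hV))
      (fun V hV W hW => hc V (Finset.mem_insert_of_mem hV) W (Finset.mem_insert_of_mem hW))
    have hUq := hq U (Finset.mem_insert_self _ _)
    have hUs := hs U (Finset.mem_insert_self _ _)
    have hcomm : ∀ m ∈ S.sup id, ∀ u ∈ U, Commute m u :=
      commute_of_mem_finset_sup fun V hV => hc V (Finset.mem_insert_of_mem hV) U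
        (Finset.mem_insert_self _ _) (fun h => hU (h ▸ hV))
    have hdisj : Disjoint (S.sup id) U := by
      rw [Subgroup.disjoint_def]
      intro x hx hxU
      exact hz U (Finset.mem_insert_self _ _) x hxU fun u hu => hcomm x hx u hu
    obtain ⟨e⟩ := exists_prod_mulEquiv_sup hcomm hdisj
    rw [Finset.sup_insert, id, sup_comm, Finset.card_insert_of_notMem hU]
    refine ⟨?_, ?_, (h3.prod hUq.le).of_injective e.symm.toMonoidHom e.symm.injective⟩
    · rw [← Nat.card_congr e.toEquiv, Nat.card_prod, h1, hUq, pow_succ]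
    · rw [← subnormalLength_congr e, subnormalLength_prod, h2]
      have := subnormalLength_le_one (G := U)
      have := subnormalLength_pos (G := U)
      omega

theorem eight_le_card_of_isSimpleGroup [Finite G] [IsSimpleGroup G]
    (hG : ¬ ∀ a b : G, a * b = b * a) : 8 ≤ Nat.card G := by
  have hp : ∀ p, p.Prime → Nat.card G ≠ p := by
    intro p hp h
    have : Fact p.Prime := ⟨hp⟩
    have := isCyclic_of_prime_card h
    exact hG fun a b => (IsCyclic.isMulCommutative (α := G)).is_comm.comm a b
  by_contra! hlt
  have h1 : 1 < Nat.card G := Finite.one_lt_card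
  have h2 := hp 2 (by norm_num)
  have h3 := hp 3 (by norm_num)
  have h5 := hp 5 (by norm_num)
  have h7 := hp 7 (by norm_num)
  obtain h | h : Nat.card G = 4 ∨ Nat.card G = 6 := by omega
  · have : Fact (Nat.Prime 2) := ⟨by norm_num⟩
    exact hG (IsPGroup.isMulCommutative_of_card_eq_prime_sq (p := 2)
      (by rw [h]; norm_num)).is_comm.comm
  · have : Fact (Nat.Prime 3) := ⟨by norm_num⟩
    obtain ⟨x, hx⟩ := exists_prime_orderOf_dvd_card' (G := G) 3 (by rw [h]; norm_num)
    have hidx : (Subgroup.zpowers x).index = 2 := by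
      have := (Subgroup.zpowers x).card_mul_index
      rw [Nat.card_zpowers, hx, h] at this
      omega
    have hn := Subgroup.normal_of_index_eq_two hidx
    rcases hn.eq_bot_or_eq_top with h' | h'
    · rw [h', Subgroup.index_bot] at hidx
      omega
    · rw [h', Subgroup.index_top] at hidx
      omega

/-- A family of subgroups that together with `A` generates a group contains a small subfamily with
the same property. -/
theorem exists_subset_sup_eq [Finite G] (A : Subgroup G) (S : Finset (Subgroup G)) :
    ∃ J ⊆ S, A ⊔ J.sup id = A ⊔ S.sup id ∧
      2 ^ J.card * Nat.card A ≤ Nat.card (A ⊔ S.sup id : Subgroup G) := by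
  classical
  induction S using Finset.induction_on with
  | empty => exact ⟨∅, subset_rfl, rfl, by simp⟩
  | insert U S hU ih =>
    obtain ⟨J, hJ, h1, h2⟩ := ih
    have hsup : A ⊔ (insert U S).sup id = U ⊔ (A ⊔ S.sup id) := by
      rw [Finset.sup_insert, id, sup_left_comm]
    rw [hsup]
    by_cases hle : U ≤ A ⊔ S.sup id
    · rw [sup_eq_right.2 hle]
      exact ⟨J, hJ.trans (Finset.subset_insert _ _), h1, h2⟩
    · refine ⟨insert U J, Finset.insert_subset_insert _ hJ, ?_, ?_⟩
      · rw [Finset.sup_insert, id, sup_left_comm, h1]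
      · rw [Finset.card_insert_of_notMem (fun h => hU (hJ h)), pow_succ]
        obtain ⟨c, hc⟩ := Subgroup.card_dvd_of_le (le_sup_right : A ⊔ S.sup id ≤ U ⊔ (A ⊔ S.sup id))
        have hc0 : c ≠ 0 := by
          rintro rfl
          exact Nat.card_pos.ne' hc
        have hc1 : c ≠ 1 := by
          rintro rfl
          have := Subgroup.eq_of_le_of_card_ge
            (le_sup_right : A ⊔ S.sup id ≤ U ⊔ (A ⊔ S.sup id)) (by rw [hc, mul_one])
          exact hle (this ▸ le_sup_left)
        have : 2 ≤ c := by omega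
        calc 2 ^ J.card * 2 * Nat.card A = 2 ^ J.card * Nat.card A * 2 := by ring
          _ ≤ _ := Nat.mul_le_mul h2 this
          _ = _ := hc.symm

end DirectProduct

section MinimalNormal

variable {G : Type u} [Group G]

/-- `U` is minimal among the nontrivial subgroups of `N` that are normalized by `N`. -/
def IsMinimalNormalizedBy (N : Subgroup G) (U : Subgroup G) : Prop :=
  Minimal (fun U : Subgroup G => U ≠ ⊥ ∧ U ≤ N ∧ ∀ a ∈ N, ∀ u ∈ U, a * u * a⁻¹ ∈ U) U

theorem mem_map_conj {U : Subgroup G} {g x : G} :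
    x ∈ U.map (MulAut.conj g).toMonoidHom ↔ g⁻¹ * x * g ∈ U := by
  constructor
  · rintro ⟨u, hu, rfl⟩
    simpa [MulAut.conj_apply, mul_assoc] using hu
  · intro h
    exact ⟨_, h, by simp [MulAut.conj_apply, mul_assoc]⟩

theorem IsMinimalNormalizedBy.map_conj {N U : Subgroup G} (hN : N.Normal)
    (hU : IsMinimalNormalizedBy N U) (g : G) :
    IsMinimalNormalizedBy N (U.map (MulAut.conj g).toMonoidHom) := by
  have key : ∀ (V : Subgroup G) (g : G),
      (V ≠ ⊥ ∧ V ≤ N ∧ ∀ a ∈ N, ∀ u ∈ V, a * u * a⁻¹ ∈ V) →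
      (V.map (MulAut.conj g).toMonoidHom ≠ ⊥ ∧ V.map (MulAut.conj g).toMonoidHom ≤ N ∧
        ∀ a ∈ N, ∀ u ∈ V.map (MulAut.conj g).toMonoidHom,
          a * u * a⁻¹ ∈ V.map (MulAut.conj g).toMonoidHom) := by
    rintro V g ⟨h1, h2, h3⟩
    refine ⟨?_, ?_, ?_⟩
    · rwa [Ne, Subgroup.map_eq_bot_iff_of_injective _ (MulAut.conj g).injective]
    · rintro _ ⟨u, hu, rfl⟩
      exact hN.conj_mem u (h2 hu) g
    · intro a ha u hu
      rw [mem_map_conj] at hu ⊢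
      have := h3 (g⁻¹ * a * g) (by simpa using hN.conj_mem a ha g⁻¹) _ hu
      simpa [mul_assoc] using this
  refine ⟨key U g hU.1, fun W hW hWU => ?_⟩
  have hW' := key W g⁻¹ hW
  have hle : W.map (MulAut.conj g⁻¹).toMonoidHom ≤ U := by
    intro x hx
    rw [mem_map_conj, inv_inv] at hx
    have := hWU hx
    rw [mem_map_conj] at this
    simpa [mul_assoc] using this
  have := hU.2 hW' hle
  intro x hx
  rw [mem_map_conj] at hx
  have := this hx
  rw [mem_map_conj] at this
  simpa [mul_assoc] using this

theorem IsMinimalNormalizedBy.commute {N U V : Subgroup G} (hU : IsMinimalNormalizedBy N U)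
    (hV : IsMinimalNormalizedBy N V) (hne : U ≠ V) {u v : G} (hu : u ∈ U) (hv : v ∈ V) :
    Commute u v := by
  have hbot : U ⊓ V = ⊥ := by
    by_contra hb
    have hp : U ⊓ V ≠ ⊥ ∧ U ⊓ V ≤ N ∧ ∀ a ∈ N, ∀ u ∈ U ⊓ V, a * u * a⁻¹ ∈ U ⊓ V :=
      ⟨hb, inf_le_left.trans hU.1.2.1,
        fun a ha x hx => ⟨hU.1.2.2 a ha x hx.1, hV.1.2.2 a ha x hx.2⟩⟩
    have h1 := hU.2 hp inf_le_left
    have h2 := hV.2 hp inf_le_right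
    exact hne (le_antisymm (h1.trans inf_le_right) (h2.trans inf_le_left))
  have hmem : u * v * u⁻¹ * v⁻¹ ∈ U ⊓ V := by
    refine Subgroup.mem_inf.2 ⟨?_, ?_⟩
    · have := hU.1.2.2 v (hV.1.2.1 hv) _ (inv_mem hu)
      simpa [mul_assoc] using mul_mem hu this
    · exact mul_mem (hV.1.2.2 u (hU.1.2.1 hu) v hv) (inv_mem hv)
  rw [hbot, Subgroup.mem_bot, mul_inv_eq_one, mul_inv_eq_iff_eq_mul] at hmem
  exact hmem

/-- A nonabelian minimal normal subgroup is generated by pairwise commuting isomorphic simple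
groups with trivial centre, permuted under conjugation. -/
theorem exists_simple_decomposition [Finite G] {N : Subgroup G} (hN : N.Normal) (hbot : N ≠ ⊥)
    (hmin : ∀ M : Subgroup G, M.Normal → M ≤ N → M ≠ ⊥ → M = N)
    (hab : ¬ ∀ a ∈ N, ∀ b ∈ N, Commute a b) :
    ∃ (S : Finset (Subgroup G)) (q : ℕ), S.sup id = N ∧ 8 ≤ q ∧ (∀ U ∈ S, Nat.card U = q) ∧
      (∀ U ∈ S, IsSimpleGroup U) ∧ (∀ U ∈ S, ∀ x ∈ U, (∀ u ∈ U, Commute x u) → x = 1) ∧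
      (∀ U ∈ S, ∀ V ∈ S, U ≠ V → ∀ u ∈ U, ∀ v ∈ V, Commute u v) ∧
      (∀ g : G, ∀ U ∈ S, U.map (MulAut.conj g).toMonoidHom ∈ S) ∧
      ∀ U ∈ S, ∀ a ∈ N, ∀ u ∈ U, a * u * a⁻¹ ∈ U := by
  classical
  obtain ⟨T, -, hT⟩ := exists_minimal_le_of_wellFoundedLT
    (fun U : Subgroup G => U ≠ ⊥ ∧ U ≤ N ∧ ∀ a ∈ N, ∀ u ∈ U, a * u * a⁻¹ ∈ U) N
    ⟨hbot, le_rfl, fun a ha u hu => mul_mem (mul_mem ha hu) (inv_mem ha)⟩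
  replace hT : IsMinimalNormalizedBy N T := hT
  let S : Finset (Subgroup G) :=
    (Set.toFinite (Set.range fun g : G => T.map (MulAut.conj g).toMonoidHom)).toFinset
  have hS : ∀ U, U ∈ S ↔ ∃ g : G, T.map (MulAut.conj g).toMonoidHom = U := by simp [S]
  have hconj : ∀ g : G, ∀ U ∈ S, U.map (MulAut.conj g).toMonoidHom ∈ S := by
    intro g U hU
    obtain ⟨h, rfl⟩ := (hS _).1 hU
    refine (hS _).2 ⟨g * h, ?_⟩
    ext x
    simp [mul_assoc]
  have hSmin : ∀ U ∈ S, IsMinimalNormalizedBy N U := by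
    intro U hU
    obtain ⟨g, rfl⟩ := (hS _).1 hU
    exact hT.map_conj hN g
  have hTS : T ∈ S := (hS _).2 ⟨1, by ext x; simp⟩
  have hcomm : ∀ U ∈ S, ∀ V ∈ S, U ≠ V → ∀ u ∈ U, ∀ v ∈ V, Commute u v :=
    fun U hU V hV hne u hu v hv => (hSmin U hU).commute (hSmin V hV) hne hu hv
  have hsup : S.sup id = N := by
    apply hmin
    · refine ⟨fun x hx g => ?_⟩
      have : S.sup id ≤ (S.sup id).comap (MulAut.conj g).toMonoidHom := by
        refine Finset.sup_le fun U hU => ?_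
        rw [id, ← Subgroup.map_le_iff_le_comap]
        exact Finset.le_sup (f := id) (hconj g U hU)
      exact this hx
    · exact Finset.sup_le fun U hU => (hSmin U hU).1.2.1
    · intro h
      exact hT.1.1 (le_bot_iff.1 (h ▸ Finset.le_sup (f := id) hTS))
  have hcard : ∀ U ∈ S, Nat.card U = Nat.card T := by
    intro U hU
    obtain ⟨g, rfl⟩ := (hS _).1 hU
    exact (Nat.card_congr (T.equivMapOfInjective _ (MulAut.conj g).injective).toEquiv).symm
  have hTab : ¬ ∀ a ∈ T, ∀ b ∈ T, Commute a b := by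
    intro h
    have hUab : ∀ U ∈ S, ∀ a ∈ U, ∀ b ∈ U, Commute a b := by
      intro U hU
      obtain ⟨g, rfl⟩ := (hS _).1 hU
      rintro _ ⟨a, ha, rfl⟩ _ ⟨b, hb, rfl⟩
      exact (h a ha b hb).map _
    refine hab fun a ha b hb => ?_
    rw [← hsup] at ha hb
    refine commute_of_mem_finset_sup (U := S.sup id) (fun V hV v hv u hu => ?_) a ha b hb
    refine (commute_of_mem_finset_sup (U := V) (fun W hW w hw v hv => ?_) u hu v hv).symm
    by_cases hWV : W = V
    · subst hWV
      exact hUab W hW w hw v hv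
    · exact hcomm W hW V hV hWV w hw v hv
  have hUnab : ∀ U ∈ S, ¬ ∀ a ∈ U, ∀ b ∈ U, Commute a b := by
    intro U hU h
    obtain ⟨g, rfl⟩ := (hS _).1 hU
    refine hTab fun a ha b hb => ?_
    have := h _ ⟨a, ha, rfl⟩ _ ⟨b, hb, rfl⟩
    exact (MulAut.conj g).injective (by simpa using this.eq)
  have hcenter : ∀ U ∈ S, ∀ x ∈ U, (∀ u ∈ U, Commute x u) → x = 1 := by
    intro U hU x hx hxc
    by_contra hx1
    have hUm := hSmin U hU
    have hZ : U ⊓ Subgroup.centralizer (U : Set G) ≠ ⊥ := fun h => hx1 <| by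
      rw [← Subgroup.mem_bot, ← h]
      exact ⟨hx, Subgroup.mem_centralizer_iff.2 fun u hu => (hxc u hu).symm.eq⟩
    have hle := hUm.2 (y := U ⊓ Subgroup.centralizer (U : Set G)) ⟨hZ,
      inf_le_left.trans hUm.1.2.1,
      fun a ha u hu => Subgroup.mem_inf.2 ⟨hUm.1.2.2 a ha u hu.1, ?_⟩⟩ inf_le_left
    · exact hUnab U hU fun a ha b hb => (Subgroup.mem_centralizer_iff.1 (hle ha).2 b hb).symm
    · rw [Subgroup.mem_centralizer_iff]
      intro y hy
      have h1 := hUm.1.2.2 a⁻¹ (inv_mem ha) y hy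
      have h2 := Subgroup.mem_centralizer_iff.1 hu.2 _ h1
      rw [inv_inv] at h2
      calc y * (a * u * a⁻¹) = a * (a⁻¹ * y * a * u) * a⁻¹ := by group
        _ = a * (u * (a⁻¹ * y * a)) * a⁻¹ := by rw [h2]
        _ = a * u * a⁻¹ * y := by group
  have hsimple : ∀ U ∈ S, IsSimpleGroup U := by
    intro U hU
    have hUm := hSmin U hU
    have : Nontrivial U := (Subgroup.nontrivial_iff_ne_bot U).2 hUm.1.1
    refine ⟨fun W hW => ?_⟩
    by_cases hWb : W = ⊥
    · exact Or.inl hWb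
    right
    have hWU : W.map U.subtype ≤ U := Subgroup.map_subtype_le W
    have hnorm : S.sup id ≤ Subgroup.normalizer (W.map U.subtype : Subgroup G) := by
      refine Finset.sup_le fun V hV v hv => ?_
      rw [Subgroup.mem_normalizer_iff]
      by_cases hVU : V = U
      · subst hVU
        intro x
        constructor
        · rintro ⟨w, hw, rfl⟩
          exact ⟨_, hW.conj_mem w hw ⟨v, hv⟩, rfl⟩
        · rintro ⟨w, hw, hx⟩
          refine ⟨_, hW.conj_mem w hw ⟨v⁻¹, inv_mem hv⟩, ?_⟩
          have hx' : (w : G) = v * x * v⁻¹ := hx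
          simp [hx', mul_assoc]
      · intro x
        constructor
        · intro hx
          have := hcomm V hV U hU hVU v hv x (hWU hx)
          rwa [this.eq, mul_inv_cancel_right]
        · intro hx
          have := hcomm V hV U hU hVU v hv _ (hWU hx)
          have h2 : v * x * v⁻¹ = x := by
            have h3 := this.eq
            calc v * x * v⁻¹ = v⁻¹ * (v * (v * x * v⁻¹)) := by group
              _ = v⁻¹ * (v * x * v⁻¹ * v) := by rw [h3]
              _ = x := by group
          rwa [h2] at hx
    have hle := hUm.2 (y := W.map U.subtype) ⟨?_, hWU.trans hUm.1.2.1, ?_⟩ hWU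
    · rw [eq_top_iff]
      rintro ⟨x, hx⟩ _
      obtain ⟨w, hw, hwx⟩ := hle hx
      have : w = ⟨x, hx⟩ := Subtype.ext hwx
      exact this ▸ hw
    · rwa [Ne, Subgroup.map_eq_bot_iff_of_injective _ Subtype.val_injective]
    · intro a ha u hu
      rw [← hsup] at ha
      exact (Subgroup.mem_normalizer_iff.1 (hnorm ha) u).1 hu
  refine ⟨S, Nat.card T, hsup, ?_, hcard, hsimple, hcenter, hcomm, hconj,
    fun U hU => (hSmin U hU).1.2.2⟩
  have := hsimple T hTS
  refine eight_le_card_of_isSimpleGroup fun h => hTab fun a ha b hb => ?_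
  exact congrArg Subtype.val (h ⟨a, ha⟩ ⟨b, hb⟩)

end MinimalNormal

section Actions

open MulAction

theorem card_le_card_orbits {G : Type u} {Ω : Type v} {Y : Type*} [Group G] [MulAction G Ω]
    [Finite Ω] (f : Ω → Y) (hf : Function.Surjective f) (hG : ∀ (g : G) x, f (g • x) = f x) :
    Nat.card Y ≤ Nat.card (orbitRel.Quotient G Ω) := by
  have : Finite (orbitRel.Quotient G Ω) := Quotient.finite _
  refine Nat.card_le_card_of_surjective (Quotient.lift f ?_) ?_
  · rintro _ b ⟨g, rfl⟩
    exact hG g b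
  · intro y
    obtain ⟨x, rfl⟩ := hf y
    exact ⟨Quotient.mk _ x, rfl⟩

variable {G Ω : Type u} [Group G] [MulAction G Ω]

theorem card_mul_card_stabilizer [IsPretransitive G Ω] (α : Ω) :
    Nat.card Ω * Nat.card (stabilizer G α) = Nat.card G := by
  rw [← index_stabilizer_of_transitive G α, mul_comm, Subgroup.card_mul_index]

theorem subnormalLength_add_stabilizer [Finite G] (N : Subgroup G) [N.Normal]
    [IsPretransitive N Ω] (α : Ω) :
    subnormalLength G + subnormalLength (stabilizer N α) =
      subnormalLength N + subnormalLength (stabilizer G α) := by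
  let f : stabilizer G α →* G ⧸ N := (QuotientGroup.mk' N).comp (stabilizer G α).subtype
  let i : stabilizer N α →* stabilizer G α :=
    (N.subtype.comp (stabilizer N α).subtype).codRestrict _ fun x => x.2
  have hi : Function.Injective i := fun x y h =>
    Subtype.ext (Subtype.ext (congrArg (fun z : stabilizer G α => (z : G)) h))
  have hf : Function.Surjective f := by
    intro y
    obtain ⟨g, rfl⟩ := QuotientGroup.mk'_surjective N y
    obtain ⟨m, hm⟩ := exists_smul_eq N (g • α) α
    refine ⟨⟨m * g, ?_⟩, ?_⟩
    · rw [mem_stabilizer_iff, mul_smul]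
      exact hm
    · simp [f]
  have hex : i.range = f.ker := by
    ext ⟨x, hx⟩
    simp only [MonoidHom.mem_range, MonoidHom.mem_ker, f, MonoidHom.comp_apply,
      Subgroup.subtype_apply, QuotientGroup.mk'_apply, QuotientGroup.eq_one_iff]
    constructor
    · rintro ⟨y, hy⟩
      have hy' : (y.1 : G) = x := congrArg Subtype.val hy
      exact hy' ▸ y.1.2
    · intro h
      exact ⟨⟨⟨x, h⟩, hx⟩, rfl⟩
  have h1 := subnormalLength_eq_of_exact i f hi hf hex
  have h2 := subnormalLength_eq_of_exact N.subtype (QuotientGroup.mk' N) Subtype.val_injective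
    (QuotientGroup.mk'_surjective _) (by simp)
  omega

theorem eq_one_of_commute_transitive [FaithfulSMul G Ω] (N : Subgroup G) [IsPretransitive N Ω]
    {α : Ω} {g : G} (hg : g • α = α) (hc : ∀ a ∈ N, Commute g a) : g = 1 := by
  refine FaithfulSMul.eq_of_smul_eq_smul (α := Ω) fun x => ?_
  obtain ⟨⟨a, ha⟩, rfl⟩ := exists_smul_eq N α x
  change g • a • α = 1 • a • α
  rw [one_smul, ← mul_smul, (hc a ha).eq, mul_smul, hg]

theorem two_pow_cardFactors_le {n : ℕ} (hn : n ≠ 0) : 2 ^ ArithmeticFunction.cardFactors n ≤ n := by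
  rw [ArithmeticFunction.cardFactors_apply]
  conv_rhs => rw [← Nat.prod_primeFactorsList hn]
  exact List.pow_card_le_prod _ _ fun p hp => (Nat.prime_of_mem_primeFactorsList hp).two_le

theorem cardFactors_le_log {m n : ℕ} (hm : m ≠ 0) (hmn : m ≤ n) :
    ArithmeticFunction.cardFactors m ≤ Nat.log 2 n :=
  Nat.le_log_of_pow_le one_lt_two ((two_pow_cardFactors_le hm).trans hmn)

theorem three_mul_cardFactors_mul_log_le {n : ℕ} (hn : 2 ≤ n) :
    3 * (ArithmeticFunction.cardFactors n * (1 + Nat.log 2 (n - 1))) + 4 ≤ 4 * n := by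
  have hk := two_pow_cardFactors_le (n := n) (by omega)
  have hL := Nat.pow_log_le_self 2 (x := n - 1) (by omega)
  have hL' := Nat.lt_pow_succ_log_self one_lt_two (n - 1)
  have h5 : ArithmeticFunction.cardFactors 5 = 1 :=
    ArithmeticFunction.cardFactors_apply_prime (by norm_num)
  have h9 : ArithmeticFunction.cardFactors 9 = 2 :=
    ArithmeticFunction.cardFactors_apply_prime_pow (p := 3) (k := 2) (by norm_num)
  have hkn5 : n = 5 → ArithmeticFunction.cardFactors n = 1 := by rintro rfl; exact h5
  have hkn9 : n = 9 → ArithmeticFunction.cardFactors n = 2 := by rintro rfl; exact h9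
  generalize ArithmeticFunction.cardFactors n = k at *
  generalize Nat.log 2 (n - 1) = L at *
  have hkL : k ≤ L + 1 := by
    have : 2 ^ k ≤ 2 ^ (L + 1) := by rw [Nat.succ_eq_add_one] at hL'; omega
    exact (Nat.pow_le_pow_iff_right one_lt_two).1 this
  rcases Nat.lt_or_ge L 4 with h | h
  · interval_cases L <;> interval_cases k <;> omega
  · have key1 : ∀ L, 4 ≤ L → 3 * (L * (1 + L)) ≤ 4 * 2 ^ L := by
      intro L hL
      induction L, hL using Nat.le_induction with
      | base => norm_num
      | succ m hm ih => rw [pow_succ]; nlinarith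
    have key2 : ∀ L, 4 ≤ L → 3 * ((L + 1) * (1 + L)) + 4 ≤ 4 * 2 ^ (L + 1) := by
      intro L hL
      induction L, hL using Nat.le_induction with
      | base => norm_num
      | succ m hm ih => rw [pow_succ]; nlinarith
    rcases hkL.eq_or_lt with rfl | hlt
    · have := key2 L h
      omega
    · have h1 := key1 L h
      have h2 : k * (1 + L) ≤ L * (1 + L) := Nat.mul_le_mul_right _ (by omega)
      omega

theorem bijective_smul_of_commute [FaithfulSMul G Ω] {N : Subgroup G} [IsPretransitive N Ω]
    (hab : ∀ a ∈ N, ∀ b ∈ N, Commute a b) (α : Ω) :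
    Function.Bijective fun a : N => a • α := by
  refine ⟨fun a b h => ?_, exists_smul_eq N α⟩
  have h' : (b⁻¹ * a : G) • α = α := by
    rw [mul_smul]
    exact inv_smul_eq_iff.2 h
  have := eq_one_of_commute_transitive N h' fun c hc =>
    hab _ (mul_mem (inv_mem b.2) a.2) _ hc
  exact Subtype.ext (inv_mul_eq_one.1 this).symm

theorem cardFactors_card_le_of_commute [Finite G] [Finite Ω] [FaithfulSMul G Ω] {N : Subgroup G}
    [IsPretransitive N Ω] (hab : ∀ a ∈ N, ∀ b ∈ N, Commute a b)
    (hN : N.Normal) (α : Ω) (H : Subgroup G) (hH : H ≤ stabilizer G α) :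
    ArithmeticFunction.cardFactors (Nat.card H) + Nat.log 2 (Nat.card Ω - 1) *
      ArithmeticFunction.cardFactors (Nat.card (N ⊓ Subgroup.centralizer (H : Set G) : Subgroup G))
      ≤ Nat.log 2 (Nat.card Ω - 1) * ArithmeticFunction.cardFactors (Nat.card N) := by
  have hbij := bijective_smul_of_commute (Ω := Ω) hab α
  induction H using WellFoundedLT.induction with
  | ind H ih =>
    have hmono : ∀ {A B : Subgroup G}, A ≤ B → ArithmeticFunction.cardFactors (Nat.card A) ≤
        ArithmeticFunction.cardFactors (Nat.card B) := by
      intro A B hAB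
      obtain ⟨c, hc⟩ := Subgroup.card_dvd_of_le hAB
      have hc0 : c ≠ 0 := by rintro rfl; exact Nat.card_pos.ne' hc
      rw [hc, ArithmeticFunction.cardFactors_mul Nat.card_pos.ne' hc0]
      omega
    have hmono' : ∀ {A B : Subgroup G}, A < B → ArithmeticFunction.cardFactors (Nat.card A) + 1 ≤
        ArithmeticFunction.cardFactors (Nat.card B) := by
      intro A B hAB
      obtain ⟨c, hc⟩ := Subgroup.card_dvd_of_le hAB.le
      have hc0 : c ≠ 0 := by rintro rfl; exact Nat.card_pos.ne' hc
      have hc1 : c ≠ 1 := by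
        rintro rfl
        exact hAB.ne (Subgroup.eq_of_le_of_card_ge hAB.le (by rw [hc, mul_one]))
      rw [hc, ArithmeticFunction.cardFactors_mul Nat.card_pos.ne' hc0]
      have := ArithmeticFunction.cardFactors_pos_iff_one_lt.2 (show 1 < c by omega)
      omega
    by_cases hbot : H = ⊥
    · subst hbot
      have := Nat.mul_le_mul_left (Nat.log 2 (Nat.card Ω - 1))
        (hmono (inf_le_left : N ⊓ Subgroup.centralizer ((⊥ : Subgroup G) : Set G) ≤ N))
      simpa using this
    obtain ⟨h, hh, h1⟩ := H.bot_or_exists_ne_one.resolve_left hbot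
    obtain ⟨w, hw, hwc⟩ : ∃ w ∈ N, ¬ Commute h w := by
      by_contra! hcon
      exact h1 (eq_one_of_commute_transitive N (hH hh) hcon)
    have hcomm : ∀ g : G, g • α = α → g • w • α = w • α → Commute g w := by
      intro g hg hgw
      have hgα : g⁻¹ • α = α := inv_smul_eq_iff.2 hg.symm
      have : (⟨g * w * g⁻¹, hN.conj_mem w hw g⟩ : N) = ⟨w, hw⟩ := hbij.1 <| by
        change (g * w * g⁻¹) • α = w • α
        rw [mul_smul, hgα, mul_smul, hgw]
      exact mul_inv_eq_iff_eq_mul.1 (congrArg Subtype.val this)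
    have hlt : H ⊓ stabilizer G (w • α) < H := by
      refine lt_of_le_of_ne inf_le_left fun heq => hwc (hcomm h (hH hh) ?_)
      have : h ∈ H ⊓ stabilizer G (w • α) := by rwa [heq]
      exact this.2
    have hih := ih _ hlt (inf_le_left.trans hH)
    have hcent : N ⊓ Subgroup.centralizer (H : Set G) <
        N ⊓ Subgroup.centralizer ((H ⊓ stabilizer G (w • α) : Subgroup G) : Set G) := by
      refine lt_of_le_of_ne
        (inf_le_inf_left _ (Subgroup.centralizer_le (fun x hx => hx.1))) fun heq => ?_
      have hmem : w ∈ N ⊓ Subgroup.centralizer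
          ((H ⊓ stabilizer G (w • α) : Subgroup G) : Set G) :=
        Subgroup.mem_inf.2 ⟨hw, Subgroup.mem_centralizer_iff.2
          fun g hg => (hcomm g (hH hg.1) hg.2).eq⟩
      rw [← heq] at hmem
      exact hwc (Subgroup.mem_centralizer_iff.1 hmem.2 h hh)
    have hmul := Nat.mul_le_mul_left (Nat.log 2 (Nat.card Ω - 1)) (hmono' hcent)
    rw [mul_add, mul_one] at hmul
    have hcardH : Nat.card H = (stabilizer H (w • α)).index *
        Nat.card (H ⊓ stabilizer G (w • α) : Subgroup G) := by
      rw [← (stabilizer H (w • α)).index_mul_card]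
      congr 1
      have e : stabilizer H (w • α) = (H ⊓ stabilizer G (w • α)).subgroupOf H := by
        ext x
        simp [Subgroup.mem_subgroupOf, mem_stabilizer_iff, Subgroup.smul_def]
      rw [e]
      exact Nat.card_congr (Subgroup.subgroupOfEquivOfLe inf_le_left).toEquiv
    have hidx : (stabilizer H (w • α)).index ≤ Nat.card Ω - 1 := by
      rw [index_stabilizer]
      have hsub : orbit H (w • α) ⊆ {α}ᶜ := by
        rintro _ ⟨⟨g, hg⟩, rfl⟩ hgα
        have hgα' : g • w • α = α := hgα
        have hwα : w • α = α := smul_left_cancel g (hgα'.trans (hH hg).symm)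
        have := congrArg Subtype.val
          (hbij.1 (a₁ := ⟨w, hw⟩) (a₂ := 1) (by simpa [Subgroup.smul_def] using hwα))
        have hw1 : w = 1 := this
        exact hwc (hw1 ▸ Commute.one_right h)
      have := Set.ncard_le_ncard hsub (Set.toFinite _)
      rwa [Set.ncard_compl, Set.ncard_singleton] at this
    rw [hcardH, ArithmeticFunction.cardFactors_mul Subgroup.index_ne_zero_of_finite
      Nat.card_pos.ne']
    have := cardFactors_le_log Subgroup.index_ne_zero_of_finite hidx
    omega

theorem subnormalLength_le_of_commute [Finite G] [Finite Ω] [Nontrivial Ω] [FaithfulSMul G Ω]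
    {N : Subgroup G} [IsPretransitive N Ω] (hab : ∀ a ∈ N, ∀ b ∈ N, Commute a b)
    (hN : N.Normal) : 3 * subnormalLength G + 4 ≤ 4 * Nat.card Ω := by
  obtain ⟨α⟩ : Nonempty Ω := inferInstance
  have : IsPretransitive G Ω := ⟨fun x y => by
    obtain ⟨a, ha⟩ := exists_smul_eq N x y
    exact ⟨a, ha⟩⟩
  have h1 := cardFactors_card_le_of_commute hab hN α _ le_rfl
  rw [Nat.card_congr (Equiv.ofBijective _ (bijective_smul_of_commute (Ω := Ω) hab α))] at h1
  have h2 := subnormalLength_le_cardFactors (G := G)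
  rw [← card_mul_card_stabilizer (G := G) α, ArithmeticFunction.cardFactors_mul Nat.card_pos.ne'
    Nat.card_pos.ne'] at h2
  have h3 := three_mul_cardFactors_mul_log_le (n := Nat.card Ω) Finite.one_lt_card
  rw [mul_add, mul_one, mul_comm _ (Nat.log 2 _)] at h3
  omega

end Actions

section NonabelianSocle

open MulAction

theorem sq_le_of_pow_le {n k t : ℕ} (hn : 64 ≤ n) (htk : t ≤ k) (h2 : 2 ^ t ≤ n)
    (h8 : 8 ^ (k - t) ≤ n) : k ^ 2 ≤ n := by
  rcases Nat.lt_or_ge k 9 with h | h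
  · nlinarith
  have key : ∀ k, 8 ≤ k → k ^ 8 ≤ 8 ^ k := by
    intro k hk
    induction k, hk using Nat.le_induction with
    | base => norm_num
    | succ m hm ih =>
      have h9 : (8 * (m + 1)) ^ 8 ≤ (9 * m) ^ 8 := Nat.pow_le_pow_left (by omega) 8
      rw [mul_pow, mul_pow] at h9
      rw [pow_succ 8 m]
      omega
  have h1 : 8 ^ k ≤ n ^ 4 := by
    calc 8 ^ k = (2 ^ t) ^ 3 * 8 ^ (k - t) := by
          rw [← pow_mul, mul_comm t 3, pow_mul, show (2 : ℕ) ^ 3 = 8 from rfl, ← pow_add,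
            Nat.add_sub_cancel' htk]
      _ ≤ n ^ 3 * n := Nat.mul_le_mul (Nat.pow_le_pow_left h2 3) h8
      _ = n ^ 4 := by ring
  refine (Nat.pow_le_pow_iff_left (n := 4) (by norm_num)).1 ?_
  rw [← pow_mul]
  exact (key k (by omega)).trans h1

theorem card_nonidentity_le {G : Type u} [Group G] [Finite G] {q : ℕ} (S : Finset (Subgroup G))
    (hq : ∀ U ∈ S, Nat.card U = q) :
    Nat.card {x : G // x ≠ 1 ∧ ∃ U ∈ S, x ∈ U} ≤ S.card * (q - 1) := by
  classical
  have hfin : ∀ U : Subgroup G, (U : Set G).Finite := fun U => Set.toFinite _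
  let F : Finset G := S.biUnion fun U => (hfin U).toFinset.erase 1
  have hF : ∀ x, x ∈ F ↔ x ≠ 1 ∧ ∃ U ∈ S, x ∈ U := by
    intro x
    simp only [F, Finset.mem_biUnion, Finset.mem_erase, Set.Finite.mem_toFinset, SetLike.mem_coe]
    tauto
  rw [← Nat.card_congr (Equiv.subtypeEquivRight hF), Nat.card_eq_fintype_card, Fintype.card_coe]
  refine Finset.card_biUnion_le_card_mul _ _ _ fun U hU => ?_
  rw [Finset.card_erase_of_mem (by simp), ← hq U hU]
  refine Nat.sub_le_sub_right (le_of_eq ?_) 1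
  rw [← Set.ncard_eq_toFinset_card]
  rfl

variable {G Ω : Type u} [Group G] [MulAction G Ω] [Finite G] [Finite Ω] [FaithfulSMul G Ω]

theorem card_finset_sq_le {N : Subgroup G} [IsPretransitive N Ω] {q : ℕ} (S : Finset (Subgroup G))
    (hsup : S.sup id = N) (h8 : 8 ≤ q) (hq : ∀ U ∈ S, Nat.card U = q)
    (hs : ∀ U ∈ S, IsSimpleGroup U)
    (hz : ∀ U ∈ S, ∀ x ∈ U, (∀ u ∈ U, Commute x u) → x = 1)
    (hc : ∀ U ∈ S, ∀ V ∈ S, U ≠ V → ∀ u ∈ U, ∀ v ∈ V, Commute u v)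
    (hnorm : ∀ U ∈ S, ∀ a ∈ N, ∀ u ∈ U, a * u * a⁻¹ ∈ U) (α : Ω) (hn : 64 ≤ Nat.card Ω) :
    S.card ^ 2 ≤ Nat.card Ω := by
  classical
  have hcardA : Nat.card (N ⊓ stabilizer G α : Subgroup G) = Nat.card (stabilizer N α) := by
    have e : stabilizer N α = (N ⊓ stabilizer G α).subgroupOf N := by
      ext x
      simp [Subgroup.mem_subgroupOf, mem_stabilizer_iff, Subgroup.smul_def]
    rw [e]
    exact (Nat.card_congr (Subgroup.subgroupOfEquivOfLe inf_le_left).toEquiv).symm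
  obtain ⟨J, hJS, hJ, hJc⟩ := exists_subset_sup_eq (N ⊓ stabilizer G α) S
  have hAN : (N ⊓ stabilizer G α) ⊔ S.sup id = N := by rw [hsup]; exact sup_eq_right.2 inf_le_left
  rw [hAN] at hJ hJc
  rw [← card_mul_card_stabilizer (G := N) α, hcardA] at hJc
  have h2 : 2 ^ J.card ≤ Nat.card Ω := Nat.le_of_mul_le_mul_right hJc Nat.card_pos
  have hsub : S \ J ⊆ S := Finset.sdiff_subset
  obtain ⟨hR, -, -⟩ := card_and_subnormalLength_finset_sup (S \ J)
    (fun U hU => hq U (hsub hU)) (fun U hU => hs U (hsub hU)) (fun U hU => hz U (hsub hU))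
    (fun U hU V hV => hc U (hsub hU) V (hsub hV))
  set R : Subgroup G := (S \ J).sup id with hRdef
  have hRN : R ≤ N := hsup ▸ Finset.sup_mono hsub
  have hRnorm : ∀ a ∈ N, ∀ r ∈ R, a * r * a⁻¹ ∈ R := by
    intro a ha
    have : R ≤ R.comap (MulAut.conj a).toMonoidHom := by
      refine Finset.sup_le fun U hU u hu => ?_
      have hUR : U ≤ R := Finset.le_sup (f := id) hU
      exact hUR (hnorm U (hsub hU) a ha u hu)
    exact fun r hr => this hr
  have hRJ : ∀ r ∈ R, ∀ m ∈ J.sup id, Commute r m := by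
    refine commute_of_mem_finset_sup fun U hU u hu m hm => ?_
    refine (commute_of_mem_finset_sup (fun V hV v hv u hu => ?_) m hm u hu).symm
    refine hc V (hJS hV) U (hsub hU) (fun h => ?_) v hv u hu
    exact (Finset.mem_sdiff.1 hU).2 (h ▸ hV)
  have hnormal : N ≤ Subgroup.normalizer ((R ⊓ stabilizer G α : Subgroup G) : Set G) := by
    rw [← hJ]
    refine sup_le ?_ ?_
    · have hstep : ∀ a ∈ N ⊓ stabilizer G α, ∀ r ∈ R ⊓ stabilizer G α,
          a * r * a⁻¹ ∈ R ⊓ stabilizer G α := fun a ha r hr =>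
        Subgroup.mem_inf.2 ⟨hRnorm a ha.1 r hr.1, mul_mem (mul_mem ha.2 hr.2) (inv_mem ha.2)⟩
      intro a ha
      rw [Subgroup.mem_normalizer_iff]
      intro r
      refine ⟨hstep a ha r, fun h => ?_⟩
      have := hstep a⁻¹ (inv_mem ha) _ h
      simpa [mul_assoc] using this
    · refine le_trans ?_ (Subgroup.centralizer_le_normalizer
        ((R ⊓ stabilizer G α : Subgroup G) : Set G))
      intro m hm
      exact Subgroup.mem_centralizer_iff.2 fun r hr => (hRJ r hr.1 m hm).eq
  have htriv : ∀ r ∈ R, r • α = α → r = 1 := by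
    intro r hr hrα
    refine FaithfulSMul.eq_of_smul_eq_smul (α := Ω) fun x => ?_
    obtain ⟨⟨a, ha⟩, rfl⟩ := exists_smul_eq N α x
    have hmem := (Subgroup.mem_normalizer_iff.1 (hnormal (inv_mem ha)) r).1
      (Subgroup.mem_inf.2 ⟨hr, hrα⟩)
    have h3 : (a⁻¹ * r * a⁻¹⁻¹) • α = α := (Subgroup.mem_inf.1 hmem).2
    rw [inv_inv, mul_assoc, mul_smul, inv_smul_eq_iff, mul_smul] at h3
    rw [one_smul]
    exact h3
  have hRle : Nat.card R ≤ Nat.card Ω := by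
    refine Nat.card_le_card_of_injective (fun r : R => r • α) fun r s hrs => ?_
    have h3 : ((s⁻¹ * r : R) : G) • α = α := by
      change (s⁻¹ * r : R) • α = α
      rw [mul_smul, inv_smul_eq_iff]
      exact hrs
    have h4 := htriv _ (s⁻¹ * r : R).2 h3
    exact (inv_mul_eq_one.1 (Subtype.ext h4 : (s⁻¹ * r : R) = 1)).symm
  rw [hR, Finset.card_sdiff_of_subset hJS] at hRle
  exact sq_le_of_pow_le hn (Finset.card_le_card hJS) h2
    ((Nat.pow_le_pow_left h8 _).trans hRle)

theorem subnormalLength_le_of_not_commute {N : Subgroup G} [IsPretransitive N Ω] (hN : N.Normal)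
    (hbot : N ≠ ⊥) (hmin : ∀ M : Subgroup G, M.Normal → M ≤ N → M ≠ ⊥ → M = N)
    (hab : ¬ ∀ a ∈ N, ∀ b ∈ N, Commute a b) (α : Ω)
    (h1 : 3 * subnormalLength (stabilizer G α) + 8 ≤ 4 * Nat.card Ω)
    (h2 : ∀ (X : Type u) [MulAction (stabilizer G α) X] [FaithfulSMul (stabilizer G α) X]
      [Finite X] [Nonempty X], Nat.card X ≤ Nat.card Ω →
      3 * subnormalLength (stabilizer G α) + 4 ≤ 4 * Nat.card X) :
    3 * subnormalLength G + 4 ≤ 4 * Nat.card Ω := by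
  obtain ⟨S, q, hsup, h8, hq, hs, hz, hc, hconj, hnorm⟩ :=
    exists_simple_decomposition hN hbot hmin hab
  obtain ⟨c1, c2, c3⟩ := card_and_subnormalLength_finset_sup S hq hs hz hc
  rw [hsup] at c1 c2 c3
  have hadd := subnormalLength_add_stabilizer N α
  rw [c2] at hadd
  have hA := c3 (stabilizer N α)
  generalize subnormalLength (stabilizer N α) = c at hadd hA
  by_cases hk : S.card ≤ c + 1
  · omega
  obtain ⟨d, hd⟩ := Nat.exists_eq_add_of_le (show c + 2 ≤ S.card by omega)
  have hqn : q ^ 2 ≤ Nat.card Ω := by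
    have h3 : q ^ (2 + d) * q ^ c ≤ Nat.card Ω * q ^ c := by
      calc q ^ (2 + d) * q ^ c = Nat.card N := by rw [c1, hd, ← pow_add]; congr 1; ring
        _ = Nat.card Ω * Nat.card (stabilizer N α) := (card_mul_card_stabilizer α).symm
        _ ≤ _ := Nat.mul_le_mul_left _ hA
    have h4 := Nat.le_of_mul_le_mul_right h3 (pow_pos (by omega) c)
    exact (Nat.pow_le_pow_right (by omega) (by omega)).trans h4
  have hkn : S.card ^ 2 ≤ Nat.card Ω :=
    card_finset_sq_le S hsup h8 hq hs hz hc hnorm α (by nlinarith)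
  have hkq : S.card * q ≤ Nat.card Ω := by nlinarith [sq_nonneg ((S.card : ℤ) - q)]
  let X := {x : G // x ≠ 1 ∧ ∃ U ∈ S, x ∈ U}
  have hXcard : Nat.card X ≤ S.card * (q - 1) := card_nonidentity_le S hq
  have hX : Nonempty X := by
    obtain ⟨U, hU⟩ := Finset.card_pos.1 (show 0 < S.card by omega)
    have := hs U hU
    obtain ⟨x, hx⟩ := exists_ne (1 : U)
    exact ⟨x, fun h => hx (Subtype.ext h), U, hU, x.2⟩
  let _ : MulAction (stabilizer G α) X :=
    { smul := fun g x => ⟨g * x * (g : G)⁻¹, by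
        obtain ⟨x, hx, U, hU, hxU⟩ := x
        refine ⟨fun h => hx (by simpa using h), _, hconj g U hU, mem_map_conj.2 ?_⟩
        simpa [mul_assoc] using hxU⟩
      one_smul := fun x => Subtype.ext (by
        change ((1 : stabilizer G α) : G) * x * ((1 : stabilizer G α) : G)⁻¹ = x
        simp)
      mul_smul := fun g h x => Subtype.ext (by
        change ((g * h : stabilizer G α) : G) * x * ((g * h : stabilizer G α) : G)⁻¹ =
          g * (h * x * (h : G)⁻¹) * (g : G)⁻¹
        simp [mul_assoc]) }
  have hfaith : FaithfulSMul (stabilizer G α) X := by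
    have : IsPretransitive N Ω := inferInstance
    have key : ∀ g : stabilizer G α, (∀ x : X, g • x = x) → g = 1 := by
      intro g hg
      refine Subtype.ext (eq_one_of_commute_transitive N g.2 fun a ha => ?_)
      rw [← hsup] at ha
      refine (commute_of_mem_finset_sup (U := Subgroup.zpowers (g : G)) (fun V hV v hv u hu => ?_)
        a ha g (Subgroup.mem_zpowers _)).symm
      obtain ⟨z, rfl⟩ := hu
      refine Commute.zpow_right ?_ z
      by_cases hv1 : v = 1
      · exact hv1 ▸ Commute.one_left _
      · have := congrArg Subtype.val (hg ⟨v, hv1, V, hV, hv⟩)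
        exact (mul_inv_eq_iff_eq_mul.1 this : (g : G) * v = v * g).symm
    refine ⟨fun {g h} hgh => ?_⟩
    have := key (h⁻¹ * g) fun x => by rw [mul_smul, hgh, inv_smul_smul]
    exact (inv_mul_eq_one.1 this).symm
  have hmul : S.card * (q - 1) + S.card = S.card * q := by
    rw [← Nat.mul_succ, Nat.succ_eq_add_one, Nat.sub_add_cancel (by omega)]
  have := h2 X (by omega)
  omega

end NonabelianSocle

section Main

open MulAction

theorem subnormalLength_le_add_ker {G : Type u} [Group G] [Finite G] {m : ℕ}
    (ih : ∀ (K X : Type u) [Group K] [MulAction K X] [Finite K] [Finite X] [FaithfulSMul K X],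
      Nat.card K + Nat.card X < m →
      3 * subnormalLength K + 4 * Nat.card (orbitRel.Quotient K X) ≤ 4 * Nat.card X)
    (Y : Type u) [MulAction G Y] [Finite Y] [Nonempty Y] (hY : Nat.card G + Nat.card Y < m) :
    3 * subnormalLength G + 4 ≤
      4 * Nat.card Y + 3 * subnormalLength (toPermHom G Y).ker := by
  have hadd := subnormalLength_eq_ker_add_range (toPermHom G Y)
  have hcongr := subnormalLength_congr (QuotientGroup.quotientKerEquivRange (toPermHom G Y))
  have hcard : Nat.card (toPermHom G Y).range ≤ Nat.card G :=
    Nat.card_le_card_of_surjective _ (toPermHom G Y).rangeRestrict_surjective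
  have := ih (toPermHom G Y).range Y (by omega)
  have : Finite (orbitRel.Quotient (toPermHom G Y).range Y) := Quotient.finite _
  have : Nonempty (orbitRel.Quotient (toPermHom G Y).range Y) :=
    ‹Nonempty Y›.map (Quotient.mk _)
  have := Nat.card_pos (α := orbitRel.Quotient (toPermHom G Y).range Y)
  omega

/-- The orbits of a normal subgroup are permuted by the whole group. -/
abbrev orbitsMulAction {G Ω : Type u} [Group G] [MulAction G Ω] (M : Subgroup G)
    (hM : M.Normal) : MulAction G (orbitRel.Quotient M Ω) where
  smul g := Quotient.map (g • ·) fun x y ⟨a, ha⟩ =>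
    ⟨⟨g * a * g⁻¹, hM.conj_mem a a.2 g⟩, by
      have ha' : (a : G) • y = x := ha
      change (g * a * g⁻¹) • g • y = g • x
      rw [← ha', mul_smul, inv_smul_smul, mul_smul]⟩
  one_smul := by
    rintro ⟨x⟩
    exact congrArg (Quotient.mk _) (one_smul G x)
  mul_smul g h := by
    rintro ⟨x⟩
    exact congrArg (Quotient.mk _) (mul_smul g h x)

theorem Subgroup.card_lt_of_ne_top {G : Type u} [Group G] [Finite G] {K : Subgroup G}
    (hK : K ≠ ⊤) : Nat.card K < Nat.card G :=
  lt_of_le_of_ne (Nat.card_le_card_of_injective _ K.subtype_injective)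
    fun h => hK (Subgroup.eq_top_of_card_eq K h)

theorem card_orbits_eq_one (G Ω : Type u) [Group G] [MulAction G Ω] [IsPretransitive G Ω]
    [Nonempty Ω] : Nat.card (orbitRel.Quotient G Ω) = 1 := by
  have := (pretransitive_iff_subsingleton_quotient G Ω).1 inferInstance
  have : Nonempty (orbitRel.Quotient G Ω) := ‹Nonempty Ω›.map (Quotient.mk _)
  exact Nat.card_unique

section Cases

variable {G Ω : Type u} [Group G] [MulAction G Ω] [Finite G] [Finite Ω] [FaithfulSMul G Ω]
  (ih : ∀ (K X : Type u) [Group K] [MulAction K X] [Finite K] [Finite X] [FaithfulSMul K X],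
    Nat.card K + Nat.card X < Nat.card G + Nat.card Ω →
    3 * subnormalLength K + 4 * Nat.card (orbitRel.Quotient K X) ≤ 4 * Nat.card X)

include ih

theorem subnormalLength_le_of_not_pretransitive {g : G} {β : Ω} (hg : g • β ≠ β)
    (ht : ¬ IsPretransitive G Ω) :
    3 * subnormalLength G + 4 * Nat.card (orbitRel.Quotient G Ω) ≤ 4 * Nat.card Ω := by
  classical
  have hβ : orbit G β ≠ Set.univ := fun h => ht <| by
    refine ⟨fun x y => ?_⟩
    obtain ⟨a, rfl⟩ : x ∈ orbit G β := h ▸ Set.mem_univ x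
    obtain ⟨b, rfl⟩ : y ∈ orbit G β := h ▸ Set.mem_univ y
    exact ⟨b * a⁻¹, by simp [mul_smul]⟩
  have hY : Nat.card (orbit G β) < Nat.card Ω := by
    have := Set.ncard_lt_card hβ
    rwa [← Nat.card_coe_set_eq] at this
  have : Nonempty (orbit G β) := ⟨⟨β, mem_orbit_self β⟩⟩
  have h1 := subnormalLength_le_add_ker ih (orbit G β) (Nat.add_lt_add_left hY _)
  let K := (toPermHom G (orbit G β)).ker
  have hfix : ∀ k ∈ K, ∀ x ∈ orbit G β, k • x = x := fun k hk x hx =>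
    congrArg Subtype.val (Equiv.ext_iff.1 (MonoidHom.mem_ker.1 hk) ⟨x, hx⟩)
  have hK : K ≠ ⊤ := fun h => hg (hfix g (h ▸ Subgroup.mem_top g) β (mem_orbit_self β))
  have h2 := ih K Ω (by have := Subgroup.card_lt_of_ne_top hK; omega)
  let q : Ω → orbitRel.Quotient G Ω := Quotient.mk _
  have hq : ∀ x, q x = q β ↔ x ∈ orbit G β := fun x => Quotient.eq''.trans orbitRel_apply
  have hqg : ∀ (g : G) x, q (g • x) = q x := fun g x =>
    Quotient.sound (mem_orbit x g)
  let φ : Ω → orbit G β ⊕ {o : orbitRel.Quotient G Ω // o ≠ q β} := fun x =>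
    if h : x ∈ orbit G β then .inl ⟨x, h⟩ else .inr ⟨q x, fun h' => h ((hq x).1 h')⟩
  have h3 := card_le_card_orbits (G := K) φ (by
    rintro (⟨x, hx⟩ | ⟨⟨x⟩, hx⟩)
    · exact ⟨x, by simp only [φ, dif_pos hx]⟩
    · have : x ∉ orbit G β := fun h => hx ((hq x).2 h)
      exact ⟨x, by simp only [φ, dif_neg this]; rfl⟩) (by
    rintro ⟨k, hk⟩ x
    by_cases hx : x ∈ orbit G β
    · exact congrArg φ (hfix k hk x hx)
    · have hx' : k • x ∉ orbit G β := fun h => hx ((hq x).1 ((hqg k x).symm.trans ((hq _).2 h)))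
      change φ (k • x) = φ x
      simp only [φ, dif_neg hx, dif_neg hx', hqg])
  have : Finite (orbitRel.Quotient G Ω) := Quotient.finite _
  have h4 := Nat.card_congr (Equiv.optionSubtypeNe (q β))
  rw [Finite.card_option] at h4
  rw [Nat.card_sum] at h3
  change _ ≤ _ + 3 * subnormalLength K at h1
  omega

theorem subnormalLength_le_of_normal_not_pretransitive [Nonempty Ω] [IsPretransitive G Ω]
    {M : Subgroup G} (hM : M.Normal) (hbot : M ≠ ⊥) (ht : ¬ IsPretransitive M Ω) :
    3 * subnormalLength G + 4 * Nat.card (orbitRel.Quotient G Ω) ≤ 4 * Nat.card Ω := by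
  let _ := orbitsMulAction (Ω := Ω) M hM
  let q : Ω → orbitRel.Quotient M Ω := Quotient.mk _
  have hqs : Function.Surjective q := Quotient.mk_surjective
  have hqg : ∀ (g : G) x, q (g • x) = g • q x := fun g x => rfl
  have hqM : ∀ (g : M) x, q (g • x) = q x := fun g x => Quotient.sound (mem_orbit x g)
  have : Finite (orbitRel.Quotient M Ω) := Quotient.finite _
  have : Nonempty (orbitRel.Quotient M Ω) := ‹Nonempty Ω›.map q
  have hY : Nat.card (orbitRel.Quotient M Ω) < Nat.card Ω := by
    refine lt_of_le_of_ne (Nat.card_le_card_of_surjective q hqs) fun h => hbot ?_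
    have hinj := (hqs.bijective_of_nat_card_le h.ge).1
    refine (Subgroup.eq_bot_iff_forall M).2 fun g hg => ?_
    refine FaithfulSMul.eq_of_smul_eq_smul (α := Ω) fun x => ?_
    rw [one_smul]
    exact hinj (hqM ⟨g, hg⟩ x)
  have h1 := subnormalLength_le_add_ker ih (orbitRel.Quotient M Ω) (Nat.add_lt_add_left hY _)
  let K := (toPermHom G (orbitRel.Quotient M Ω)).ker
  have hfix : ∀ k ∈ K, ∀ y : orbitRel.Quotient M Ω, k • y = y := fun k hk y =>
    Equiv.ext_iff.1 (MonoidHom.mem_ker.1 hk) y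
  have hK : K ≠ ⊤ := fun h => ht <| by
    refine (pretransitive_iff_subsingleton_quotient M Ω).2 ⟨fun a b => ?_⟩
    obtain ⟨x, rfl⟩ := hqs a
    obtain ⟨y, rfl⟩ := hqs b
    obtain ⟨g, rfl⟩ := exists_smul_eq G x y
    rw [hqg, hfix g (h ▸ Subgroup.mem_top g)]
  have h2 := ih K Ω (by have := Subgroup.card_lt_of_ne_top hK; omega)
  have h3 := card_le_card_orbits (G := K) q hqs fun k x => hfix k k.2 (q x)
  have h4 := card_orbits_eq_one G Ω
  change _ ≤ _ + 3 * subnormalLength K at h1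
  omega

theorem subnormalLength_le_of_forall_normal_pretransitive [Nontrivial Ω] [IsPretransitive G Ω]
    (ht : ∀ M : Subgroup G, M.Normal → M ≠ ⊥ → IsPretransitive M Ω) :
    3 * subnormalLength G + 4 ≤ 4 * Nat.card Ω := by
  obtain ⟨α, β, hαβ⟩ := exists_pair_ne Ω
  obtain ⟨g, hg⟩ := exists_smul_eq G α β
  have hG : (⊤ : Subgroup G) ≠ ⊥ := fun h => hαβ <| by
    have : g = 1 := Subgroup.mem_bot.1 (h ▸ Subgroup.mem_top g)
    rw [← hg, this, one_smul]
  obtain ⟨N, -, hN⟩ := exists_minimal_le_of_wellFoundedLT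
    (fun M : Subgroup G => M.Normal ∧ M ≠ ⊥) ⊤ ⟨inferInstance, hG⟩
  have := ht N hN.prop.1 hN.prop.2
  by_cases hab : ∀ a ∈ N, ∀ b ∈ N, Commute a b
  · exact subnormalLength_le_of_commute hab hN.prop.1
  have hstab : stabilizer G α ≠ ⊤ := fun h => hαβ <| by
    have : g ∈ stabilizer G α := h ▸ Subgroup.mem_top g
    rw [← hg]
    exact this.symm
  have hcard := Subgroup.card_lt_of_ne_top hstab
  refine subnormalLength_le_of_not_commute hN.prop.1 hN.prop.2
    (fun M hM hle hbot => hN.eq_of_le ⟨hM, hbot⟩ hle) hab α ?_ fun X _ _ _ _ hX => ?_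
  · have h1 := ih (stabilizer G α) Ω (by omega)
    have h2 := card_le_card_orbits (G := stabilizer G α) (fun x : Ω => x = α) (by
      intro p
      by_cases hp : p
      · exact ⟨α, by simp [hp]⟩
      · exact ⟨β, by simp [hp, hαβ.symm]⟩) (by
      intro k x
      refine propext ⟨fun h => ?_, fun h => ?_⟩
      · exact smul_left_cancel k (h.trans k.2.symm)
      · rw [h]; exact k.2)
    have h3 : Nat.card Prop = 2 := by simp
    omega
  · have h1 := ih (stabilizer G α) X (by omega)
    have : Finite (orbitRel.Quotient (stabilizer G α) X) := Quotient.finite _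
    have : Nonempty (orbitRel.Quotient (stabilizer G α) X) := ‹Nonempty X›.map (Quotient.mk _)
    have := Nat.card_pos (α := orbitRel.Quotient (stabilizer G α) X)
    omega

end Cases

theorem subnormalLength_add_card_orbits_le (G Ω : Type u) [Group G] [MulAction G Ω] [Finite G]
    [Finite Ω] [FaithfulSMul G Ω] :
    3 * subnormalLength G + 4 * Nat.card (orbitRel.Quotient G Ω) ≤ 4 * Nat.card Ω := by
  induction hm : Nat.card G + Nat.card Ω using Nat.strong_induction_on generalizing G Ω with
  | _ m IH =>
    subst hm
    have ih : ∀ (K X : Type u) [Group K] [MulAction K X] [Finite K] [Finite X]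
        [FaithfulSMul K X], Nat.card K + Nat.card X < Nat.card G + Nat.card Ω →
        3 * subnormalLength K + 4 * Nat.card (orbitRel.Quotient K X) ≤ 4 * Nat.card X :=
      fun K X _ _ _ _ _ h => IH _ h K X rfl
    rcases subsingleton_or_nontrivial G with hG | hG
    · rw [subnormalLength_eq_zero]
      have : Nat.card (orbitRel.Quotient G Ω) ≤ Nat.card Ω :=
        Nat.card_le_card_of_surjective _ Quotient.mk_surjective
      omega
    obtain ⟨g, hg⟩ := exists_ne (1 : G)
    obtain ⟨β, hβ⟩ : ∃ β : Ω, g • β ≠ β := by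
      by_contra! h
      exact hg (FaithfulSMul.eq_of_smul_eq_smul (α := Ω) fun x => by rw [h, one_smul])
    by_cases ht : IsPretransitive G Ω
    · have : Nontrivial Ω := ⟨_, _, hβ⟩
      by_cases hM : ∀ M : Subgroup G, M.Normal → M ≠ ⊥ → IsPretransitive M Ω
      · have := subnormalLength_le_of_forall_normal_pretransitive ih hM
        have := card_orbits_eq_one G Ω
        omega
      · push Not at hM
        obtain ⟨M, h1, h2, h3⟩ := hM
        exact subnormalLength_le_of_normal_not_pretransitive ih h1 h2 h3
    · exact subnormalLength_le_of_not_pretransitive ih hβ ht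

theorem HasSubnormalSeries.of_chain {G : Type u} [Group G] {n : ℕ} (H : Fin (n + 1) → Subgroup G)
    (hmono : StrictMono H)
    (hnormal : ∀ i : Fin n, ((H i.castSucc).subgroupOf (H i.succ)).Normal) (i : Fin (n + 1)) :
    HasSubnormalSeries i (H i) := by
  induction i using Fin.induction with
  | zero => exact trivial
  | succ i ih =>
    have hlt : H i.castSucc < H i.succ := hmono i.castSucc_lt_succ
    rw [Fin.val_succ]
    refine ⟨_, hnormal i, fun h => ?_, ih.congr (Subgroup.subgroupOfEquivOfLe hlt.le).symm⟩
    exact hlt.not_ge (Subgroup.subgroupOf_eq_top.1 h)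

end Main

/-- Any composition series of a permutation group `G ≤ Sym(Ω)` with `|Ω| = n` and `s`
orbits has length at most `4(n - s)/3`. -/
theorem composition_series_length_le (Ω : Type*) [Fintype Ω] (n s : ℕ)
    (hn : Fintype.card Ω = n) (G : Subgroup (Equiv.Perm Ω))
    (hs : Nat.card (MulAction.orbitRel.Quotient G Ω) = s)
    (u : ℕ) (H : Fin (u + 1) → Subgroup G)
    (hmono : StrictMono H) (hbot : H 0 = ⊥) (htop : H (Fin.last u) = ⊤)
    (hnormal : ∀ i : Fin u, ((H i.castSucc).subgroupOf (H i.succ)).Normal)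
    (hsimplefactors : ∀ i : Fin u,
      letI := hnormal i
      IsSimpleGroup (H i.succ ⧸ (H i.castSucc).subgroupOf (H i.succ))) :
    (u : ℚ) ≤ 4 * ((n : ℚ) - s) / 3 := by
  have h1 := HasSubnormalSeries.of_chain H hmono hnormal (Fin.last u)
  rw [htop, Fin.val_last] at h1
  have h2 := (h1.congr Subgroup.topEquiv).le_subnormalLength
  have h3 := subnormalLength_add_card_orbits_le G Ω
  rw [hs, Nat.card_eq_fintype_card (α := Ω), hn] at h3
  have h4 : (3 * u + 4 * s : ℚ) ≤ 4 * n := by exact_mod_cast (by omega : 3 * u + 4 * s ≤ 4 * n)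
  linarith
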